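/- arXiv:1412.3359 — 6 statements merged into one kernel-verified Lean document; each statement's English description precedes it below -/
import Mathlib

section
/- Suppose C_e(s1,t) + C_e(s2,t) > C_e(s1,s2,t). Then every minimum-weight edge cut F separating {s1,s2} from t is connectivity preserving: after deleting the edges of F from G, the vertices s1 and s2 are still connected. -/
open SimpleGraph

open Classical in
/-- Edges of `F` with exactly one endpoint in `S`. -/
noncomputable def bdry {V : Type*} (F : Finset (Sym2 V)) (S : Set V) : Finset (Sym2 V) :=
  F.filter (fun e => ∃ a ∈ S, ∃ b, b ∉ S ∧ e = s(a, b))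

theorem bdry_sub {V : Type*} (F : Finset (Sym2 V)) (S : Set V) : bdry F S ⊆ F := by
  intro e he
  simp only [bdry, Finset.mem_filter] at he
  exact he.1

theorem bdry_cut {V : Type*} (G : SimpleGraph V) (F : Finset (Sym2 V)) (S : Set V)
    (hS : ∀ a ∈ S, ∀ b, (G.deleteEdges (F : Set (Sym2 V))).Adj a b → b ∈ S) (s t : V)
    (hs : s ∈ S) (ht : t ∉ S) :
    ¬ (G.deleteEdges (bdry F S : Set (Sym2 V))).Reachable s t := by
  rintro ⟨p⟩
  apply ht
  clear ht
  induction p with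
  | nil => exact hs
  | @cons u v _ h p ih =>
    apply ih
    by_contra hv
    rw [SimpleGraph.deleteEdges_adj] at h
    apply hv
    apply hS u hs
    rw [SimpleGraph.deleteEdges_adj]
    refine ⟨h.1, fun hF => h.2 ?_⟩
    simp only [bdry, Finset.coe_filter, Set.mem_ofPred_eq]
    exact ⟨hF, u, hs, v, hv, rfl⟩

/-- If `C_e(s1,t) + C_e(s2,t) > C_e(s1,s2,t)`, then every minimum-weight
edge cut separating `{s1, s2}` from `t` is connectivity preserving: after deleting its
edges, `s1` and `s2` are still connected. -/
theorem stmt_0 {V : Type*} [Fintype V] [DecidableEq V]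
    (G : SimpleGraph V) (w : Sym2 V → ℝ)
    (hw : ∀ e ∈ G.edgeSet, 0 < w e)
    (s1 s2 t : V) (h1t : s1 ≠ t) (h2t : s2 ≠ t) (h12 : s1 ≠ s2)
    (c1 c2 c12 : ℝ)
    (hc1 : IsLeast {x : ℝ | ∃ F : Finset (Sym2 V), ↑F ⊆ G.edgeSet ∧
      ¬ (G.deleteEdges ↑F).Reachable s1 t ∧ x = ∑ e ∈ F, w e} c1)
    (hc2 : IsLeast {x : ℝ | ∃ F : Finset (Sym2 V), ↑F ⊆ G.edgeSet ∧
      ¬ (G.deleteEdges ↑F).Reachable s2 t ∧ x = ∑ e ∈ F, w e} c2)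
    (hc12 : IsLeast {x : ℝ | ∃ F : Finset (Sym2 V), ↑F ⊆ G.edgeSet ∧
      ¬ (G.deleteEdges ↑F).Reachable s1 t ∧ ¬ (G.deleteEdges ↑F).Reachable s2 t ∧
      x = ∑ e ∈ F, w e} c12)
    (hlt : c12 < c1 + c2)
    (F : Finset (Sym2 V)) (hFE : ↑F ⊆ G.edgeSet)
    (hF1 : ¬ (G.deleteEdges ↑F).Reachable s1 t)
    (hF2 : ¬ (G.deleteEdges ↑F).Reachable s2 t)
    (hFmin : ∑ e ∈ F, w e = c12) :
    (G.deleteEdges ↑F).Reachable s1 s2 := by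
  classical
  by_contra hn
  set H := G.deleteEdges (F : Set (Sym2 V)) with hH
  let S1 : Set V := {v | H.Reachable s1 v}
  let S2 : Set V := {v | H.Reachable s2 v}
  have cl1 : ∀ a ∈ S1, ∀ b, H.Adj a b → b ∈ S1 := fun a ha b hab => ha.trans hab.reachable
  have cl2 : ∀ a ∈ S2, ∀ b, H.Adj a b → b ∈ S2 := fun a ha b hab => ha.trans hab.reachable
  have cl : ∀ a ∈ S1 ∪ S2, ∀ b, H.Adj a b → b ∈ S1 ∪ S2 := fun a ha b hab =>
    ha.imp (fun h => cl1 a h b hab) (fun h => cl2 a h b hab)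
  have hs1 : s1 ∈ S1 := SimpleGraph.Reachable.refl _
  have hs2 : s2 ∈ S2 := SimpleGraph.Reachable.refl _
  have ht : t ∉ S1 ∪ S2 := by
    rintro (h | h)
    · exact hF1 h
    · exact hF2 h
  have hdis : ∀ v, v ∈ S1 → v ∉ S2 := fun v h1 h2 => hn (h1.trans h2.symm)
  have sub : ∀ S, bdry F S ⊆ F := fun S => bdry_sub F S
  have subG : ∀ S, (bdry F S : Set (Sym2 V)) ⊆ G.edgeSet := fun S =>
    (Finset.coe_subset.2 (sub S)).trans hFE
  have k1 := hc1.2 ⟨bdry F S1, subG _, bdry_cut G F S1 cl1 s1 t hs1 hF1, rfl⟩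
  have k2 := hc2.2 ⟨bdry F S2, subG _, bdry_cut G F S2 cl2 s2 t hs2 hF2, rfl⟩
  have k3 := hc12.2 ⟨bdry F (S1 ∪ S2), subG _,
    bdry_cut G F _ cl s1 t (Or.inl hs1) ht, bdry_cut G F _ cl s2 t (Or.inr hs2) ht, rfl⟩
  have hpos : ∀ e ∈ F, 0 ≤ w e := fun e he => (hw e (hFE he)).le
  have e1 := Finset.sum_union_inter (s₁ := bdry F S1) (s₂ := bdry F S2) (f := w)
  have e2 : ∑ e ∈ bdry F S1 ∪ bdry F S2, w e ≤ ∑ e ∈ F, w e :=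
    Finset.sum_le_sum_of_subset_of_nonneg (Finset.union_subset (sub _) (sub _))
      (fun e he _ => hpos e he)
  have hd : Disjoint (bdry F (S1 ∪ S2)) (bdry F S1 ∩ bdry F S2) := by
    rw [Finset.disjoint_left]
    intro e h h'
    simp only [bdry, Finset.mem_inter, Finset.mem_filter] at h h'
    obtain ⟨-, p, hp, q, hq, rfl⟩ := h
    obtain ⟨⟨-, a, ha, b, hb, hab⟩, -, c, hc, d, hd, hcd⟩ := h'
    rw [Set.mem_union, not_or] at hq
    rw [Sym2.eq_iff] at hab hcd
    rcases hab with ⟨rfl, rfl⟩ | ⟨rfl, rfl⟩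
    · rcases hcd with ⟨rfl, rfl⟩ | ⟨rfl, rfl⟩
      · exact hdis _ ha hc
      · exact hq.2 hc
    · exact hq.1 ha
  have e3 : ∑ e ∈ bdry F (S1 ∪ S2) ∪ (bdry F S1 ∩ bdry F S2), w e ≤ ∑ e ∈ F, w e :=
    Finset.sum_le_sum_of_subset_of_nonneg
      (Finset.union_subset (sub _) (Finset.inter_subset_left.trans (sub _)))
      (fun e he _ => hpos e he)
  rw [Finset.sum_union hd] at e3
  linarith
end

section
/- Let n1 be a positive integer with n1 ≤ |S|, let OPT be the maximum coverage number in C over all subsets of S of size n1, and let OPT₂ be the maximum coverage number in C² over all subsets of S of size n1. Let ζ ≥ 1 be a real number. If S' is a subset of S of size n1 whose coverage number in C² is at least OPT₂ / ζ, then the coverage number of S' in C is at least OPT / √ζ. -/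
/-- The coverage number of `S'` in `C`: the number of members of `C`, counted with
multiplicity, fully covered by (i.e. contained in) `S'`. -/
def coverNum {α : Type*} [DecidableEq α] (C : Multiset (Finset α)) (S' : Finset α) : ℕ :=
  (C.filter (fun A => A ⊆ S')).card

/-- The multiset `C²`: unions `A ∪ B` over all ordered pairs of members of `C`,
with all repetitions kept. -/
def msq {α : Type*} [DecidableEq α] (C : Multiset (Finset α)) : Multiset (Finset α) :=
  C.bind (fun A => C.map (fun B => A ∪ B))

theorem coverNum_bind_aux {α : Type*} [DecidableEq α] (C D : Multiset (Finset α)) (T : Finset α) :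
    coverNum (C.bind (fun A => D.map (fun B => A ∪ B))) T = coverNum C T * coverNum D T := by
  induction C using Multiset.induction_on with
  | empty => simp [coverNum]
  | cons A C ih =>
    unfold coverNum at *
    rw [Multiset.cons_bind, Multiset.filter_add, Multiset.card_add, ih, Multiset.filter_map,
      Multiset.card_map]
    by_cases h : A ⊆ T
    · rw [Multiset.filter_cons_of_pos (p := fun A => A ⊆ T) _ h, Multiset.card_cons]
      have : D.filter ((fun A => A ⊆ T) ∘ fun B => A ∪ B) = D.filter (fun A => A ⊆ T) := by
        apply Multiset.filter_congr
        intro B _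
        simp [Finset.union_subset_iff, h]
      rw [this]
      ring
    · rw [Multiset.filter_cons_of_neg (p := fun A => A ⊆ T) _ h]
      have : D.filter ((fun A => A ⊆ T) ∘ fun B => A ∪ B) = 0 := by
        rw [Multiset.filter_eq_nil]
        intro B _
        simp [Finset.union_subset_iff, h]
      rw [this]
      simp

theorem coverNum_msq_aux {α : Type*} [DecidableEq α] (C : Multiset (Finset α)) (T : Finset α) :
    coverNum (msq C) T = coverNum C T * coverNum C T := coverNum_bind_aux C C T

/-- If `S'` of size `n1` has coverage number in `C²` at least `OPT₂ / ζ`,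
then its coverage number in `C` is at least `OPT / √ζ`. -/
theorem stmt_6 {α : Type*} [DecidableEq α] (S : Finset α)
    (C : Multiset (Finset α)) (hC : ∀ A ∈ C, A ⊆ S)
    (n1 : ℕ) (hn1 : 1 ≤ n1) (hn1S : n1 ≤ S.card)
    (OPT OPT₂ : ℕ)
    (hOPT : OPT = (S.powersetCard n1).sup (fun S' => coverNum C S'))
    (hOPT₂ : OPT₂ = (S.powersetCard n1).sup (fun S' => coverNum (msq C) S'))
    (ζ : ℝ) (hζ : 1 ≤ ζ)
    (S' : Finset α) (hS' : S' ⊆ S) (hS'card : S'.card = n1)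
    (hcov : (OPT₂ : ℝ) / ζ ≤ (coverNum (msq C) S' : ℝ)) :
    (OPT : ℝ) / Real.sqrt ζ ≤ (coverNum C S' : ℝ) := by
  have hne : (S.powersetCard n1).Nonempty := Finset.powersetCard_nonempty.2 hn1S
  obtain ⟨T, hT, hTe⟩ := Finset.exists_mem_eq_sup _ hne (fun S' => coverNum C S')
  have h2 : OPT * OPT ≤ OPT₂ := by
    rw [hOPT, hTe, hOPT₂, ← coverNum_msq_aux]
    exact Finset.le_sup (f := fun S' => coverNum (msq C) S') hT
  have h3 : (OPT : ℝ) * OPT ≤ OPT₂ := by exact_mod_cast h2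
  have hz : 0 < ζ := by linarith
  rw [coverNum_msq_aux, div_le_iff₀ hz] at hcov
  push_cast at hcov
  rw [div_le_iff₀ (Real.sqrt_pos.2 hz)]
  refine le_of_abs_le (abs_le_of_sq_le_sq ?_ ?_)
  · rw [mul_pow, Real.sq_sqrt hz.le]
    nlinarith
  · positivity
end

section
/- The minimum cost of a threshold cut of G' equals n³/2 plus the minimum value of a bisection of G. -/
open SimpleGraph

/-- The graph `G'` obtained from `G` by adding one new vertex (`none`) adjacent to every
vertex of `G`. -/
def augGraph {V : Type*} (G : SimpleGraph V) : SimpleGraph (Option V) :=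
  SimpleGraph.fromRel (fun a b => a = none ∨ ∃ u v, a = some u ∧ b = some v ∧ G.Adj u v)

-- Edge costs in `G'` (for a graph `G` on `n` vertices): an edge incident to the new
-- vertex `none` costs `n²`; the original edges of `G` cost `1`.
open Classical in
noncomputable def eCost {V : Type*} (n : ℕ) (e : Sym2 (Option V)) : ℝ :=
  if (none : Option V) ∈ e then (n : ℝ) ^ 2 else 1

/-- The value of the bisection `(P, Pᶜ)` of `G`: the number of edges of `G` with one
endpoint in each part. -/
noncomputable def bisVal {V : Type*} (G : SimpleGraph V) (P : Finset V) : ℕ :=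
  {e ∈ G.edgeSet | ∃ u v, e = s(u, v) ∧ u ∈ P ∧ v ∉ P}.ncard

theorem aug_none {V : Type*} (G : SimpleGraph V) (v : V) : (augGraph G).Adj none (some v) := by
  simp [augGraph]

theorem aug_some {V : Type*} (G : SimpleGraph V) (u v : V) :
    (augGraph G).Adj (some u) (some v) ↔ G.Adj u v := by
  simp only [augGraph, SimpleGraph.fromRel_adj]
  constructor
  · rintro ⟨_, (h | ⟨a, b, h1, h2, h⟩) | (h | ⟨a, b, h1, h2, h⟩)⟩
    · cases h
    · cases h1; cases h2; exact h
    · cases h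
    · cases h1; cases h2; exact h.symm
  · intro h
    refine ⟨fun e => h.ne (Option.some.inj e), Or.inl (Or.inr ⟨u, v, rfl, rfl, h⟩)⟩

def bset {V : Type*} (G : SimpleGraph V) (P : Finset V) : Set (Sym2 V) :=
  {e ∈ G.edgeSet | ∃ u v, e = s(u, v) ∧ u ∈ P ∧ v ∉ P}

open Classical in
noncomputable def cutF {V : Type*} [Fintype V] (G : SimpleGraph V) (S : Finset V) :
    Finset (Sym2 (Option V)) :=
  S.image (fun v => s(none, some v)) ∪ (bset G S).toFinset.image (Sym2.map some)

theorem none_notMem {V : Type*} (e : Sym2 V) : (none : Option V) ∉ Sym2.map some e := by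
  simp [Sym2.mem_map]

theorem cutF_cost {V : Type*} [Fintype V] (G : SimpleGraph V) (S : Finset V) (n : ℕ) :
    ∑ e ∈ cutF G S, eCost n e = (n : ℝ) ^ 2 * S.card + bisVal G S := by
  classical
  unfold cutF
  rw [Finset.sum_union, Finset.sum_image, Finset.sum_image]
  · have h1 : ∀ x ∈ S, eCost n s(none, some x) = (n : ℝ) ^ 2 := by
      intro x _; simp [eCost]
    have h2 : ∀ x ∈ (bset G S).toFinset, eCost n (Sym2.map some x) = 1 := by
      intro x _; simp [eCost]
    rw [Finset.sum_congr rfl h1, Finset.sum_congr rfl h2]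
    have h3 : bisVal G S = (bset G S).toFinset.card := by
      rw [← Set.ncard_eq_toFinset_card']; rfl
    rw [h3]
    simp [mul_comm]
  · exact (Sym2.map.injective (Option.some_injective V)).injOn
  · intro a _ b _ h
    simpa using h
  · rw [Finset.disjoint_left]
    intro e he he'
    obtain ⟨v, _, rfl⟩ := Finset.mem_image.1 he
    obtain ⟨f, _, hf⟩ := Finset.mem_image.1 he'
    exact none_notMem f (hf ▸ Sym2.mem_mk_left _ _)

theorem cutF_sub {V : Type*} [Fintype V] (G : SimpleGraph V) (S : Finset V) :
    (↑(cutF G S) : Set (Sym2 (Option V))) ⊆ (augGraph G).edgeSet := by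
  classical
  intro e he
  rcases Finset.mem_union.1 (Finset.mem_coe.1 he) with h | h
  · obtain ⟨v, _, rfl⟩ := Finset.mem_image.1 h
    exact aug_none G v
  · obtain ⟨f, hf, rfl⟩ := Finset.mem_image.1 h
    obtain ⟨h1, u, v, rfl, _, _⟩ := Set.mem_toFinset.1 hf
    exact (aug_some G u v).2 h1

theorem cutF_unreach {V : Type*} [Fintype V] (G : SimpleGraph V) (S : Finset V) (v : V)
    (hv : v ∈ S) :
    ¬ ((augGraph G).deleteEdges ↑(cutF G S)).Reachable (some v) none := by
  classical
  rintro ⟨w⟩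
  have key : ∀ (a b : Option V), ((augGraph G).deleteEdges ↑(cutF G S)).Walk a b →
      (∃ u ∈ S, a = some u) → ∃ u ∈ S, b = some u := by
    intro a b w
    induction w with
    | nil => exact id
    | @cons a b c h p ih =>
      rintro ⟨u, hu, rfl⟩
      apply ih
      rw [SimpleGraph.deleteEdges_adj] at h
      obtain ⟨h1, h2⟩ := h
      cases b with
      | none =>
        exact (h2 (Finset.mem_coe.2 (Finset.mem_union_left _
          (Finset.mem_image.2 ⟨u, hu, Sym2.eq_swap⟩)))).elim
      | some x =>
        refine ⟨x, ?_, rfl⟩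
        by_contra hx
        refine h2 (Finset.mem_coe.2 (Finset.mem_union_right _
          (Finset.mem_image.2 ⟨s(u, x), Set.mem_toFinset.2 ⟨(aug_some G u x).1 h1, u, x, rfl, hu, hx⟩, rfl⟩)))
  obtain ⟨u, _, h⟩ := key _ _ w ⟨v, hv, rfl⟩
  cases h

theorem cutF_le {V : Type*} [Fintype V] (G : SimpleGraph V) (S : Finset V)
    (F : Finset (Sym2 (Option V)))
    (hS : ∀ v, v ∈ S ↔ ¬ ((augGraph G).deleteEdges ↑F).Reachable (some v) none) :
    cutF G S ⊆ F := by
  classical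
  intro e he
  by_contra hF
  rcases Finset.mem_union.1 he with h | h
  · obtain ⟨v, hv, rfl⟩ := Finset.mem_image.1 h
    refine (hS v).1 hv (SimpleGraph.Adj.reachable ?_).symm
    rw [SimpleGraph.deleteEdges_adj]
    exact ⟨aug_none G v, hF⟩
  · obtain ⟨f, hf, rfl⟩ := Finset.mem_image.1 h
    obtain ⟨h1, u, v, rfl, hu, hv⟩ := Set.mem_toFinset.1 hf
    have hv' := not_not.1 (mt (hS v).2 hv)
    refine (hS u).1 hu (SimpleGraph.Reachable.trans (SimpleGraph.Adj.reachable ?_) hv')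
    rw [SimpleGraph.deleteEdges_adj]
    exact ⟨(aug_some G u v).2 h1, hF⟩

theorem bisVal_le {V : Type*} [Fintype V] (G : SimpleGraph V) (S : Finset V) :
    bisVal G S ≤ Fintype.card V ^ 2 := by
  classical
  calc bisVal G S ≤ (Set.univ : Set (Sym2 V)).ncard :=
        Set.ncard_le_ncard (Set.subset_univ _) (Set.toFinite _)
    _ = Fintype.card (Sym2 V) := by rw [Set.ncard_univ, Nat.card_eq_fintype_card]
    _ ≤ Fintype.card (V × V) := Fintype.card_le_of_surjective _ Sym2.mk_surjective
    _ = _ := by rw [Fintype.card_prod, sq]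

/-- The minimum cost of a threshold cut of `G'` equals `n³/2` plus the
minimum value of a bisection of `G`. -/
theorem stmt_9 {V : Type*} [Fintype V] [DecidableEq V]
    (G : SimpleGraph V) (hn : Even (Fintype.card V)) (hn2 : 2 ≤ Fintype.card V)
    (c : ℝ)
    (hc : IsLeast {x : ℝ | ∃ F : Finset (Sym2 (Option V)), ↑F ⊆ (augGraph G).edgeSet ∧
      Fintype.card V / 2 ≤
        {v : V | ¬ ((augGraph G).deleteEdges ↑F).Reachable (some v) none}.ncard ∧
      x = ∑ e ∈ F, eCost (Fintype.card V) e} c)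
    (b : ℕ)
    (hb : IsLeast {m : ℕ | ∃ P : Finset V, P.card = Fintype.card V / 2 ∧ m = bisVal G P} b) :
    c = (Fintype.card V : ℝ) ^ 3 / 2 + (b : ℝ) := by
  classical
  obtain ⟨k, hk⟩ := hn
  have hk2 : Fintype.card V / 2 = k := by omega
  have hkR : (Fintype.card V : ℝ) = 2 * k := by rw [hk]; push_cast; ring
  rw [hk2] at hc hb
  obtain ⟨⟨P, hP, hbP⟩, hbmin⟩ := hb
  obtain ⟨⟨F, hF1, hF2, hcF⟩, hcmin⟩ := hc
  apply le_antisymm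
  · have h : c ≤ ∑ e ∈ cutF G P, eCost (Fintype.card V) e := by
      refine hcmin ⟨cutF G P, cutF_sub G P, ?_, rfl⟩
      rw [← hP, ← Set.ncard_coe_finset]
      exact Set.ncard_le_ncard (fun v hv => cutF_unreach G P v hv) (Set.toFinite _)
    rw [cutF_cost, hP, ← hbP] at h
    refine h.trans (le_of_eq ?_)
    rw [hkR]; ring
  · set S : Finset V := {v : V | ¬ ((augGraph G).deleteEdges ↑F).Reachable (some v) none}.toFinset
      with hSdef
    have hS : ∀ v, v ∈ S ↔ ¬ ((augGraph G).deleteEdges ↑F).Reachable (some v) none := by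
      intro v; rw [hSdef, Set.mem_toFinset]; rfl
    rw [Set.ncard_eq_toFinset_card'] at hF2
    have h : ∑ e ∈ cutF G S, eCost (Fintype.card V) e ≤ c := by
      rw [hcF]
      refine Finset.sum_le_sum_of_subset_of_nonneg (cutF_le G S F hS) ?_
      intro e _ _
      unfold eCost
      split_ifs <;> positivity
    rw [cutF_cost] at h
    refine le_trans ?_ h
    have hkS : k ≤ S.card := by convert hF2
    rcases hkS.eq_or_lt with h1 | h1
    · have h2 : b ≤ bisVal G S := hbmin ⟨S, h1.symm, rfl⟩
      have h3 : (b : ℝ) ≤ bisVal G S := by exact_mod_cast h2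
      rw [← h1, hkR]
      nlinarith
    · have h2 : (b : ℝ) ≤ (Fintype.card V : ℝ) ^ 2 := by
        rw [hbP]; exact_mod_cast bisVal_le G P
      have h3 : (k : ℝ) + 1 ≤ S.card := by exact_mod_cast h1
      have h4 : (0 : ℝ) ≤ bisVal G S := by positivity
      have h5 := mul_le_mul_of_nonneg_left h3 (sq_nonneg (Fintype.card V : ℝ))
      rw [hkR] at *
      nlinarith
end

section
/- If F is a minimum-cost threshold cut of G', then the number of vertices of G that are not connected to A after deleting the edges of F from G' is exactly n/2. -/
open SimpleGraph

/-- If `F` is a minimum-cost threshold cut of `G'`, then the number of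
vertices of `G` not connected to the new vertex `A` after deleting `F` is exactly `n/2`. -/
theorem stmt_10 {V : Type*} [Fintype V] [DecidableEq V]
    (G : SimpleGraph V) (hn : Even (Fintype.card V)) (hn2 : 2 ≤ Fintype.card V)
    (F : Finset (Sym2 (Option V))) (hFE : ↑F ⊆ (augGraph G).edgeSet)
    (hFthr : Fintype.card V / 2 ≤
      {v : V | ¬ ((augGraph G).deleteEdges ↑F).Reachable (some v) none}.ncard)
    (hFmin : ∀ F' : Finset (Sym2 (Option V)), ↑F' ⊆ (augGraph G).edgeSet →
      Fintype.card V / 2 ≤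
        {v : V | ¬ ((augGraph G).deleteEdges ↑F').Reachable (some v) none}.ncard →
      ∑ e ∈ F, eCost (Fintype.card V) e ≤ ∑ e ∈ F', eCost (Fintype.card V) e) :
    {v : V | ¬ ((augGraph G).deleteEdges ↑F).Reachable (some v) none}.ncard =
      Fintype.card V / 2 := by
  classical
  by_contra hne
  set U : Set V := {v : V | ¬ ((augGraph G).deleteEdges ↑F).Reachable (some v) none} with hU
  have hgt : Fintype.card V / 2 < U.toFinset.card := by
    rw [← Set.ncard_eq_toFinset_card']
    exact lt_of_le_of_ne hFthr (Ne.symm hne)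
  obtain ⟨S, hSU, hScard⟩ := Finset.exists_subset_card_eq hgt.le
  have hinj : Function.Injective (fun v : V => s(some v, (none : Option V))) := by
    intro a b h
    simpa using h
  have hadj : ∀ v : V, (augGraph G).Adj (some v) none := by
    intro v
    simp [augGraph]
  -- lower bound for F
  have hlow : U.toFinset.image (fun v : V => s(some v, (none : Option V))) ⊆ F := by
    intro e he
    obtain ⟨v, hv, rfl⟩ := Finset.mem_image.1 he
    by_contra hnot
    have hv' : v ∈ U := by simpa using hv
    apply hv'
    apply SimpleGraph.Adj.reachable
    rw [SimpleGraph.deleteEdges_adj]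
    exact ⟨hadj v, by simpa using hnot⟩
  have hnn : ∀ e : Sym2 (Option V), 0 ≤ eCost (Fintype.card V) e := by
    intro e
    unfold eCost
    split_ifs <;> positivity
  have hstar : ∀ T : Finset V,
      ∑ e ∈ T.image (fun v : V => s(some v, (none : Option V))), eCost (Fintype.card V) e
        = (T.card : ℝ) * (Fintype.card V : ℝ) ^ 2 := by
    intro T
    rw [Finset.sum_image (fun a _ b _ h => hinj h)]
    simp [eCost]
  have h1 : (U.toFinset.card : ℝ) * (Fintype.card V : ℝ) ^ 2 ≤
      ∑ e ∈ F, eCost (Fintype.card V) e := by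
    rw [← hstar]
    exact Finset.sum_le_sum_of_subset_of_nonneg hlow (fun e _ _ => hnn e)
  -- the competitor
  set F' : Finset (Sym2 (Option V)) :=
    S.image (fun v : V => s(some v, (none : Option V))) ∪
      G.edgeFinset.image (Sym2.map some) with hF'
  have hF'E : (↑F' : Set (Sym2 (Option V))) ⊆ (augGraph G).edgeSet := by
    intro e he
    rw [Finset.mem_coe, hF', Finset.mem_union] at he
    rcases he with he | he
    · obtain ⟨v, hv, rfl⟩ := Finset.mem_image.1 he
      exact hadj v
    · obtain ⟨e, hv, rfl⟩ := Finset.mem_image.1 he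
      induction e using Sym2.ind with
      | _ a b =>
        have hab : G.Adj a b := by simpa using hv
        simp [augGraph, hab, hab.ne]
  have hiso : ∀ v ∈ S, ¬ ((augGraph G).deleteEdges ↑F').Reachable (some v) none := by
    rintro v hv ⟨p⟩
    cases p with
    | cons h q =>
      rename_i w
      rw [SimpleGraph.deleteEdges_adj] at h
      obtain ⟨h, hn⟩ := h
      apply hn
      rw [Finset.mem_coe, hF', Finset.mem_union]
      cases w with
      | none => exact Or.inl (Finset.mem_image_of_mem _ hv)
      | some w =>
        right
        have hvw : G.Adj v w := by
          simp [augGraph] at h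
          rcases h.2 with h | h
          · exact h
          · exact h.symm
        exact Finset.mem_image.2 ⟨s(v, w), by simpa using hvw, rfl⟩
  have hthr : Fintype.card V / 2 ≤
      {v : V | ¬ ((augGraph G).deleteEdges ↑F').Reachable (some v) none}.ncard := by
    rw [← hScard, ← Set.ncard_coe_finset]
    exact Set.ncard_le_ncard (fun v hv => hiso v hv) (Set.toFinite _)
  have h2 := hFmin F' hF'E hthr
  have h3 : ∑ e ∈ F', eCost (Fintype.card V) e ≤
      (S.card : ℝ) * (Fintype.card V : ℝ) ^ 2 + (G.edgeFinset.card : ℝ) := by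
    have hle : ∑ e ∈ G.edgeFinset.image (Sym2.map some), eCost (Fintype.card V) e
        ≤ (G.edgeFinset.card : ℝ) := by
      have : ∀ e ∈ G.edgeFinset.image (Sym2.map (some : V → Option V)),
          eCost (Fintype.card V) e ≤ 1 := by
        intro e he
        obtain ⟨e, hv, rfl⟩ := Finset.mem_image.1 he
        simp [eCost]
      refine (Finset.sum_le_sum this).trans ?_
      simp only [Finset.sum_const, nsmul_eq_mul, mul_one]
      exact_mod_cast Finset.card_image_le
    have hun := Finset.sum_union_inter
      (s₁ := S.image (fun v : V => s(some v, (none : Option V))))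
      (s₂ := G.edgeFinset.image (Sym2.map some)) (f := eCost (Fintype.card V))
    have hin := Finset.sum_nonneg (s := S.image (fun v : V => s(some v, (none : Option V))) ∩
      G.edgeFinset.image (Sym2.map some)) (fun e _ => hnn e)
    rw [hstar] at hun
    linarith
  have h4 : G.edgeFinset.card < Fintype.card V ^ 2 := by
    refine (SimpleGraph.card_edgeFinset_le_card_choose_two (G := G)).trans_lt ?_
    rw [Nat.choose_two_right]
    refine (Nat.div_le_self _ _).trans_lt ?_
    rw [sq]
    exact Nat.mul_lt_mul_of_pos_left (by omega) (by omega)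
  have h5 : (G.edgeFinset.card : ℝ) < (Fintype.card V : ℝ) ^ 2 := by exact_mod_cast h4
  have h6 : (S.card : ℝ) + 1 ≤ (U.toFinset.card : ℝ) := by
    rw [hScard]
    exact_mod_cast hgt
  nlinarith [mul_le_mul_of_nonneg_right h6 (sq_nonneg (Fintype.card V : ℝ))]
end

section
/- Let S_1, …, S_k be distinct vertices of G, all different from A, and let l be an integer with 1 ≤ l ≤ k. Then every vertex set C with A ∉ C that separates at least l of the vertices S_1, …, S_k from A has cost at least the l-th smallest value among c(S_1,A), …, c(S_k,A) (the values sorted in ascending order). -/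
open SimpleGraph

/-- A vertex set `C` (with `A ∉ C`) separates `v` from `A` if either `v ∈ C`, or `v` is
not connected to `A` in the graph obtained from `G` by deleting the vertices of `C`
(together with their incident edges). -/
def Separates {V : Type*} (G : SimpleGraph V) (A : V) (C : Finset V) (v : V) : Prop :=
  v ∈ C ∨ ¬ ∃ (hv : v ∉ C) (hA : A ∉ C),
    (G.induce {x : V | x ∉ C}).Reachable ⟨v, hv⟩ ⟨A, hA⟩

/-- Every vertex set `C` with `A ∉ C` separating at least `l` of the
vertices `S 1, …, S k` from `A` has cost at least the `l`-th smallest value `q` among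
`c(S 1, A), …, c(S k, A)`. -/
theorem stmt_12 {V : Type*} [Fintype V] [DecidableEq V]
    (G : SimpleGraph V) (c : V → ℝ) (hc : ∀ v, 0 < c v)
    (A : V) (k : ℕ) (S : Fin k → V) (hinj : Function.Injective S) (hSA : ∀ i, S i ≠ A)
    (l : ℕ) (hl1 : 1 ≤ l) (hlk : l ≤ k)
    (cv : Fin k → ℝ)
    (hcv : ∀ i, IsLeast {x : ℝ | ∃ C : Finset V, A ∉ C ∧ Separates G A C (S i) ∧
      x = ∑ u ∈ C, c u} (cv i))
    (q : ℝ)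
    (hq : ∃ σ : Equiv.Perm (Fin k), (Monotone fun i => cv (σ i)) ∧
      q = cv (σ ⟨l - 1, by omega⟩))
    (C : Finset V) (hAC : A ∉ C)
    (hsep : l ≤ {i : Fin k | Separates G A C (S i)}.ncard) :
    q ≤ ∑ u ∈ C, c u := by
  obtain ⟨σ, hm, rfl⟩ := hq
  by_contra hlt
  push Not at hlt
  have hsub : {i : Fin k | Separates G A C (S i)} ⊆
      σ '' ((Finset.Iio (⟨l - 1, by omega⟩ : Fin k) : Finset (Fin k)) : Set (Fin k)) := by
    intro i hi
    refine ⟨σ.symm i, ?_, by simp⟩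
    simp only [Finset.coe_Iio, Set.mem_Iio]
    by_contra hge
    have h1 := hm (not_lt.mp hge)
    have h2 := (hcv i).2 ⟨C, hAC, hi, rfl⟩
    simp only [Equiv.apply_symm_apply] at h1
    linarith
  have h3 := Set.ncard_le_ncard hsub (Set.toFinite _)
  rw [Set.ncard_image_of_injective _ σ.injective, Set.ncard_coe_finset, Fin.card_Iio] at h3
  simp only at h3
  omega
end

section
/- Let S_1, …, S_k be distinct vertices of G, all different from A, labelled so that c(S_1,A) ≤ c(S_2,A) ≤ … ≤ c(S_k,A), and let l be an integer with 1 ≤ l ≤ k. Then the minimum cost of a vertex set C with A ∉ C that separates every one of S_1, …, S_l from A is at most l times the minimum cost of a vertex set C' with A ∉ C' that separates at least l of the vertices S_1, …, S_k from A. -/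
open SimpleGraph

theorem Separates.mono' {V : Type*} {G : SimpleGraph V} {A : V} {C D : Finset V} {v : V}
    (h : Separates G A C v) (hCD : C ⊆ D) : Separates G A D v := by
  by_cases hvD : v ∈ D
  · exact Or.inl hvD
  · rcases h with h | h
    · exact absurd (hCD h) hvD
    · refine Or.inr ?_
      rintro ⟨hv, hA, hr⟩
      refine h ⟨fun h => hv (hCD h), fun h => hA (hCD h), ?_⟩
      have hsub : {x : V | x ∉ D} ⊆ {x : V | x ∉ C} := fun x hx hxC => hx (hCD hxC)
      exact hr.map (SimpleGraph.induceHomOfLE G hsub).toHom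

/-- With `c(S 1, A) ≤ … ≤ c(S k, A)`, the minimum cost of a vertex set
separating every one of `S 1, …, S l` from `A` is at most `l` times the minimum cost of a
vertex set separating at least `l` of the vertices `S 1, …, S k` from `A`. -/
theorem stmt_13 {V : Type*} [Fintype V] [DecidableEq V]
    (G : SimpleGraph V) (c : V → ℝ) (hc : ∀ v, 0 < c v)
    (A : V) (k : ℕ) (S : Fin k → V) (hinj : Function.Injective S) (hSA : ∀ i, S i ≠ A)
    (cv : Fin k → ℝ)
    (hcv : ∀ i, IsLeast {x : ℝ | ∃ C : Finset V, A ∉ C ∧ Separates G A C (S i) ∧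
      x = ∑ u ∈ C, c u} (cv i))
    (hsorted : Monotone cv)
    (l : ℕ) (hl1 : 1 ≤ l) (hlk : l ≤ k)
    (m1 : ℝ)
    (hm1 : IsLeast {x : ℝ | ∃ C : Finset V, A ∉ C ∧
      (∀ i : Fin k, (i : ℕ) < l → Separates G A C (S i)) ∧ x = ∑ u ∈ C, c u} m1)
    (m2 : ℝ)
    (hm2 : IsLeast {x : ℝ | ∃ C : Finset V, A ∉ C ∧
      l ≤ {i : Fin k | Separates G A C (S i)}.ncard ∧ x = ∑ u ∈ C, c u} m2) :
    m1 ≤ (l : ℝ) * m2 := by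
  obtain ⟨C', hA', hcard, hm2e⟩ := hm2.1
  have hex : ∃ i : Fin k, l - 1 ≤ (i : ℕ) ∧ Separates G A C' (S i) := by
    by_contra hne
    push Not at hne
    have hsub : {i : Fin k | Separates G A C' (S i)} ⊆
        ((Finset.univ.filter (fun i : Fin k => (i : ℕ) < l - 1) : Finset (Fin k)) : Set (Fin k)) := by
      intro i hi
      simp only [Finset.coe_filter, Finset.mem_univ, true_and, Set.mem_setOf_eq]
      by_contra hlt
      exact hne i (by omega) hi
    have h1 := Set.ncard_le_ncard hsub (Finset.finite_toSet _)
    rw [Set.ncard_coe_finset] at h1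
    have h2 : (Finset.univ.filter (fun i : Fin k => (i : ℕ) < l - 1)).card ≤
        (Finset.range (l - 1)).card :=
      Finset.card_le_card_of_injOn (fun i => (i : ℕ)) (by intro i hi; simpa using hi)
        (fun a _ b _ h => Fin.ext h)
    rw [Finset.card_range] at h2
    omega
  obtain ⟨i, hi, hsep⟩ := hex
  have hcvi : cv i ≤ m2 := (hcv i).2 ⟨C', hA', hsep, hm2e⟩
  choose C hCA hCs hCc using fun j => (hcv j).1
  set T : Finset (Fin k) := Finset.univ.filter (fun j : Fin k => (j : ℕ) < l) with hT
  have hTc : T.card ≤ l := by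
    have h2 : T.card ≤ (Finset.range l).card :=
      Finset.card_le_card_of_injOn (fun i => (i : ℕ)) (by intro i hi; simpa [hT] using hi)
        (fun a _ b _ h => Fin.ext h)
    rwa [Finset.card_range] at h2
  have hm2n : 0 ≤ m2 := by
    rw [hm2e]
    exact Finset.sum_nonneg fun u _ => (hc u).le
  have h1 : m1 ≤ ∑ u ∈ T.biUnion C, c u := by
    refine hm1.2 ⟨T.biUnion C, ?_, ?_, rfl⟩
    · simp only [Finset.mem_biUnion, not_exists, not_and]
      exact fun j _ => hCA j
    · intro j hj
      exact (hCs j).mono' (Finset.subset_biUnion_of_mem C (by simp [hT, hj]))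
  have h3 : ∀ U : Finset (Fin k), ∑ u ∈ U.biUnion C, c u ≤ ∑ j ∈ U, cv j := by
    intro U
    induction U using Finset.induction_on with
    | empty => simp
    | insert a U ha ih =>
      rw [Finset.biUnion_insert, Finset.sum_insert ha]
      have := Finset.sum_union_inter (s₁ := C a) (s₂ := U.biUnion C) (f := c)
      have h0 : 0 ≤ ∑ u ∈ C a ∩ U.biUnion C, c u := Finset.sum_nonneg fun u _ => (hc u).le
      have := hCc a
      linarith
  have h4 : ∑ j ∈ T, cv j ≤ T.card • m2 := by
    refine Finset.sum_le_card_nsmul _ _ _ fun j hj => ?_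
    have hj' : (j : ℕ) < l := by simpa [hT] using hj
    exact (hsorted (show j ≤ i from Fin.le_def.2 (by omega))).trans hcvi
  rw [nsmul_eq_mul] at h4
  have h5 : (T.card : ℝ) * m2 ≤ l * m2 :=
    mul_le_mul_of_nonneg_right (by exact_mod_cast hTc) hm2n
  linarith [h3 T]
end
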